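/- arXiv:1403.1722 — 3 statements merged into one kernel-verified Lean document; each statement's English description precedes it below -/
import Mathlib

section
/- Let 𝒜 = (Q,A,δ,λ) be a transducer that is reversible and invertible but not bireversible, i.e., there exist pairs (q,a) ≠ (q',a') in Q × A with λ(q,a) = λ(q',a') and δ(q,a) = δ(q',a'). Then the group G(𝒜) is infinite. -/
namespace Paper

variable {Q A T : Type*}

/-- Output action of a single state on a finite word. -/
def tOut (δ : Q → A → Q) (lam : Q → A → A) : Q → List A → List A
  | _, [] => []
  | q, a :: w => lam q a :: tOut δ lam (δ q a) w

/-- Output action of a word of states (leftmost letter acts first). -/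
def wOut (δ : Q → A → Q) (lam : Q → A → A) (u : List Q) (w : List A) : List A :=
  u.foldl (fun v q => tOut δ lam q v) w

/-- Section (dual action) of a word of states by a single letter. -/
def sec (δ : Q → A → Q) (lam : Q → A → A) : List Q → A → List Q
  | [], _ => []
  | q :: u, a => δ q a :: sec δ lam u (lam q a)

/-- Section of a word of states by a word of letters. -/
def secW (δ : Q → A → Q) (lam : Q → A → A) (u : List Q) (v : List A) : List Q :=
  v.foldl (sec δ lam) u

/-- Single step of the enriched alphabet `Q ⊕ Q` (second copy = formal inverses). -/
noncomputable def stepT [Nonempty A] (δ : Q → A → Q) (lam : Q → A → A) :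
    Q ⊕ Q → A → (Q ⊕ Q) × A
  | Sum.inl q, a => (Sum.inl (δ q a), lam q a)
  | Sum.inr q, a => (Sum.inr (δ q (Function.invFun (lam q) a)), Function.invFun (lam q) a)

noncomputable def tOutT [Nonempty A] (δ : Q → A → Q) (lam : Q → A → A) :
    Q ⊕ Q → List A → List A
  | _, [] => []
  | x, a :: w => (stepT δ lam x a).2 :: tOutT δ lam (stepT δ lam x a).1 w

noncomputable def wOutT [Nonempty A] (δ : Q → A → Q) (lam : Q → A → A)
    (u : List (Q ⊕ Q)) (w : List A) : List A :=
  u.foldl (fun v x => tOutT δ lam x v) w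

noncomputable def secT [Nonempty A] (δ : Q → A → Q) (lam : Q → A → A) :
    List (Q ⊕ Q) → A → List (Q ⊕ Q)
  | [], _ => []
  | x :: u, a => (stepT δ lam x a).1 :: secT δ lam u ((stepT δ lam x a).2)

noncomputable def secTW [Nonempty A] (δ : Q → A → Q) (lam : Q → A → A)
    (u : List (Q ⊕ Q)) (v : List A) : List (Q ⊕ Q) :=
  v.foldl (secT δ lam) u

/-- The automaton group as subgroup of the permutations of `A*`. -/
def autGroup (δ : Q → A → Q) (lam : Q → A → A) : Subgroup (Equiv.Perm (List A)) :=
  Subgroup.closure {g : Equiv.Perm (List A) | ∃ q : Q, ∀ w, g w = tOut δ lam q w}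

/-- Induced action of a length- and prefix-preserving map on the boundary. -/
def boundaryAct (g : List A → List A) (v : ℕ → A) : ℕ → A :=
  fun i => (g ((List.range (i + 1)).map v)).getD i (v i)

/-- The periodic sequence `w^ω`. -/
noncomputable def perSeq [Nonempty A] (w : List A) : ℕ → A :=
  fun i => w.getD (i % w.length) (Classical.arbitrary A)

/-- `u^n`: `n`-fold concatenation of a word with itself. -/
def rep (u : List A) (n : ℕ) : List A := (List.replicate n u).flatten

def Reversible (δ : Q → A → Q) : Prop := ∀ a, Function.Bijective (fun q => δ q a)

def Invertible' (lam : Q → A → A) : Prop := ∀ q, Function.Bijective (lam q)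

def Bireversible (δ : Q → A → Q) (lam : Q → A → A) : Prop :=
  Invertible' lam ∧ Reversible δ ∧
    ∀ q q' a a', lam q a = lam q' a' → δ q a = δ q' a' → (q, a) = (q', a')

def prodδ (δ₁ : Q → A → Q) (lam₁ : Q → A → A) (δ₂ : T → A → T) :
    Q × T → A → Q × T :=
  fun p a => (δ₁ p.1 a, δ₂ p.2 (lam₁ p.1 a))

def prodLam (lam₁ : Q → A → A) (lam₂ : T → A → A) : Q × T → A → A :=
  fun p a => lam₂ p.2 (lam₁ p.1 a)

end Paper

namespace Paper

variable {Q A : Type*}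

theorem tOut_bijective (δ : Q → A → Q) {lam : Q → A → A} (hinv : Invertible' lam) (q : Q) :
    Function.Bijective (tOut δ lam q) := by
  constructor
  · intro v
    induction v generalizing q with
    | nil => intro w h; cases w <;> simp_all [tOut]
    | cons a v ih =>
      intro w h
      cases w with
      | nil => simp [tOut] at h
      | cons b w =>
        simp only [tOut, List.cons.injEq] at h
        obtain rfl := (hinv q).1 h.1
        rw [ih _ h.2]
  · intro w
    induction w generalizing q with
    | nil => exact ⟨[], rfl⟩
    | cons b w ih =>
      obtain ⟨a, rfl⟩ := (hinv q).2 b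
      obtain ⟨v, rfl⟩ := ih (δ q a)
      exact ⟨a :: v, rfl⟩

/-- The permutation of `A*` induced by a state of an invertible transducer. -/
noncomputable def statePerm (δ : Q → A → Q) {lam : Q → A → A} (hinv : Invertible' lam) (q : Q) :
    Equiv.Perm (List A) :=
  Equiv.ofBijective _ (tOut_bijective δ hinv q)

theorem statePerm_apply (δ : Q → A → Q) {lam : Q → A → A} (hinv : Invertible' lam) (q : Q)
    (w : List A) : statePerm δ hinv q w = tOut δ lam q w := rfl

theorem statePerm_mem_autGroup (δ : Q → A → Q) {lam : Q → A → A} (hinv : Invertible' lam)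
    (q : Q) : statePerm δ hinv q ∈ autGroup δ lam :=
  Subgroup.subset_closure ⟨q, fun _ => rfl⟩

theorem statePerm_inv_cons (δ : Q → A → Q) {lam : Q → A → A} (hinv : Invertible' lam)
    (q : Q) (a : A) (w : List A) :
    (statePerm δ hinv q)⁻¹ (lam q a :: w) = a :: (statePerm δ hinv (δ q a))⁻¹ w := by
  rw [Equiv.Perm.inv_eq_iff_eq, statePerm_apply, tOut, ← statePerm_apply δ hinv,
    ← Equiv.Perm.mul_apply, mul_inv_cancel, Equiv.Perm.one_apply]

/-- `h` is the section of `g` at the letter `a`. -/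
def IsSection (g : Equiv.Perm (List A)) (a : A) (h : Equiv.Perm (List A)) : Prop :=
  ∃ b, ∀ w, g (a :: w) = b :: h w

theorem IsSection.unique {g h h' : Equiv.Perm (List A)} {a : A} (H : IsSection g a h)
    (H' : IsSection g a h') : h = h' := by
  obtain ⟨b, H⟩ := H
  obtain ⟨b', H'⟩ := H'
  ext1 w
  exact (List.cons.inj ((H w).symm.trans (H' w))).2

/-- In a reversible transducer generating a finite group, every element of the group is
the section at a given letter of some element of the group. -/
theorem exists_isSection_of_finite {δ : Q → A → Q} {lam : Q → A → A}
    (hrev : Reversible δ) (hinv : Invertible' lam) [Finite (autGroup δ lam)]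
    {h : Equiv.Perm (List A)} (hh : h ∈ autGroup δ lam) (a : A) :
    ∃ g ∈ autGroup δ lam, IsSection g a h := by
  have key : ∀ n : ℕ, ∀ h : Equiv.Perm (List A),
      (∀ a, ∃ g ∈ autGroup δ lam, IsSection g a h) →
      ∀ a, ∃ g ∈ autGroup δ lam, IsSection g a (h ^ n) := by
    intro n h H
    induction n with
    | zero => exact fun a => ⟨1, one_mem _, a, fun w => rfl⟩
    | succ n ih =>
      intro a
      obtain ⟨g₂, hg₂, b, h₂⟩ := H a
      obtain ⟨g₁, hg₁, c, h₁⟩ := ih b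
      exact ⟨g₁ * g₂, mul_mem hg₁ hg₂, c, fun w => by
        rw [Equiv.Perm.mul_apply, h₂, h₁, pow_succ, Equiv.Perm.mul_apply]⟩
  revert a
  induction hh using Subgroup.closure_induction with
  | mem x hx =>
    intro a
    obtain ⟨p, hp⟩ := hx
    obtain ⟨q, rfl⟩ := (hrev a).2 p
    exact ⟨statePerm δ hinv q, statePerm_mem_autGroup δ hinv q, lam q a, fun w => by
      rw [hp, statePerm_apply, tOut]⟩
  | one => exact fun a => ⟨1, one_mem _, a, fun w => rfl⟩
  | mul x y _ _ hx hy =>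
    intro a
    obtain ⟨g₂, hg₂, b, h₂⟩ := hy a
    obtain ⟨g₁, hg₁, c, h₁⟩ := hx b
    exact ⟨g₁ * g₂, mul_mem hg₁ hg₂, c, fun w => by
      rw [Equiv.Perm.mul_apply, h₂, h₁, Equiv.Perm.mul_apply]⟩
  | inv x hxG hx =>
    have hfin : IsOfFinOrder (⟨x, hxG⟩ : autGroup δ lam) := isOfFinOrder_of_finite _
    obtain ⟨n, hn, hpow⟩ := isOfFinOrder_iff_pow_eq_one.1 hfin
    have hpow' : x ^ n = 1 := congrArg Subtype.val hpow
    have hinvx : x⁻¹ = x ^ (n - 1) := by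
      rw [inv_eq_iff_mul_eq_one, ← pow_succ', Nat.sub_add_cancel hn, hpow']
    rw [hinvx]
    exact key _ x hx

/-- In a reversible transducer generating a finite group, an element of the group is
determined by its section at any letter. -/
theorem IsSection.injective_of_finite {δ : Q → A → Q} {lam : Q → A → A}
    (hrev : Reversible δ) (hinv : Invertible' lam) [Finite (autGroup δ lam)]
    {g g' h : Equiv.Perm (List A)} (hg : g ∈ autGroup δ lam) (hg' : g' ∈ autGroup δ lam)
    (hh : h ∈ autGroup δ lam) {a : A} (H : IsSection g a h) (H' : IsSection g' a h) :
    g = g' := by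
  choose f hf hfs using fun h : autGroup δ lam => exists_isSection_of_finite hrev hinv h.2 a
  let F : autGroup δ lam → autGroup δ lam := fun h => ⟨f h, hf h⟩
  have hF : Function.Injective F := fun h₁ h₂ e => by
    have e' : f h₁ = f h₂ := congrArg Subtype.val e
    exact Subtype.ext ((hfs h₁).unique (e' ▸ hfs h₂))
  have hsurj := Finite.surjective_of_injective hF
  have eq_f : ∀ k (hk : k ∈ autGroup δ lam), IsSection k a h → k = f ⟨h, hh⟩ := by
    intro k hk Hk
    obtain ⟨x, hx⟩ := hsurj ⟨k, hk⟩
    have hx' : f x = k := congrArg Subtype.val hx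
    have hxh : x = ⟨h, hh⟩ := Subtype.ext ((hfs x).unique (hx'.symm ▸ Hk))
    rw [← hxh, hx']
  rw [eq_f g hg H, eq_f g' hg' H']

end Paper

open Paper


/-- a reversible invertible transducer which is not bireversible
generates an infinite group. -/
theorem statement_7 {Q A : Type*} [Fintype Q] [Fintype A] [Nonempty Q] [Nonempty A]
    (δ : Q → A → Q) (lam : Q → A → A)
    (hrev : Reversible δ) (hinv : Invertible' lam)
    (hnb : ∃ q q' : Q, ∃ a a' : A, (q, a) ≠ (q', a') ∧
      lam q a = lam q' a' ∧ δ q a = δ q' a') :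
    Set.Infinite (autGroup δ lam : Set (Equiv.Perm (List A))) := by
  intro hfin
  have : Finite (autGroup δ lam) := hfin
  obtain ⟨q, q', a, a', hne, hl, hd⟩ := hnb
  have H : IsSection (statePerm δ hinv q)⁻¹ (lam q a) (statePerm δ hinv (δ q a))⁻¹ :=
    ⟨a, statePerm_inv_cons δ hinv q a⟩
  have H' : IsSection (statePerm δ hinv q')⁻¹ (lam q a) (statePerm δ hinv (δ q a))⁻¹ := by
    rw [hl, hd]
    exact ⟨a', statePerm_inv_cons δ hinv q' a'⟩
  have hmem := fun p => inv_mem (statePerm_mem_autGroup δ hinv p)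
  have hqq := inv_injective
    (IsSection.injective_of_finite hrev hinv (hmem q) (hmem q') (hmem _) H H')
  have hout := DFunLike.congr_fun hqq [a]
  simp only [statePerm_apply, tOut, List.cons.injEq, and_true] at hout
  obtain rfl : a = a' := (hinv q').1 (hout.symm.trans hl)
  exact hne (Prod.ext ((hrev a).1 hd) rfl)
end

section
/- Let 𝒜 = (Q,A,δ,λ) be an invertible transducer such that G(𝒜) is infinite and such that St(w^ω) = {1} for every nonempty word w ∈ A^+. Then the semigroup of self-maps of Q̃* generated by the section maps w ↦ w⟨a⟩ (a ∈ A) is torsion-free: for every u ∈ A^+ and all k, p ≥ 1, the maps w ↦ w⟨u^{k+p}⟩ and w ↦ w⟨u^k⟩ on Q̃* are distinct. -/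
namespace Paper

section

variable {Q A : Type*}

theorem rep_add (u : List A) (m n : ℕ) : rep u (m + n) = rep u m ++ rep u n := by
  rw [rep, rep, rep, List.replicate_add, List.flatten_append]

theorem length_rep (u : List A) (n : ℕ) : (rep u n).length = n * u.length := by
  simp [rep]

variable [Nonempty A]

theorem rep_getD (u : List A) (n i : ℕ) (hi : i < n * u.length) (d : A) :
    (rep u n).getD i d = perSeq u i := by
  induction n generalizing i with
  | zero => simp at hi
  | succ n ih =>
    have hrep : rep u (n + 1) = u ++ rep u n := by simp [rep, List.replicate_succ]
    rw [hrep]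
    rcases lt_or_ge i u.length with h | h
    · rw [List.getD_append _ _ _ _ h, perSeq, Nat.mod_eq_of_lt h, List.getD_eq_getElem _ _ h,
        List.getD_eq_getElem _ _ h]
    · rw [List.getD_append_right _ _ _ _ h, ih _ (by rw [add_mul] at hi; omega), perSeq, perSeq,
        ← Nat.mod_eq_sub_mod h]

theorem map_perSeq_prefix_rep {u : List A} {n m : ℕ} (h : m ≤ n * u.length) :
    (List.range m).map (perSeq u) <+: rep u n := by
  rw [List.prefix_iff_eq_take]
  refine List.ext_getElem (by simp [length_rep, h]) fun i h₁ h₂ => ?_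
  have hi : i < n * u.length := by simp at h₁; omega
  have hr := rep_getD u n i hi (Classical.arbitrary A)
  rw [List.getD_eq_getElem _ _ (by rwa [length_rep])] at hr
  simp [hr]

variable (δ : Q → A → Q) (lam : Q → A → A)

theorem length_tOutT (x : Q ⊕ Q) (v : List A) : (tOutT δ lam x v).length = v.length := by
  induction v generalizing x with
  | nil => rfl
  | cons a v ih => simp [tOutT, ih]

theorem wOutT_cons (x : Q ⊕ Q) (w : List (Q ⊕ Q)) (v : List A) :
    wOutT δ lam (x :: w) v = wOutT δ lam w (tOutT δ lam x v) := rfl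

theorem wOutT_append_left (w₁ w₂ : List (Q ⊕ Q)) (v : List A) :
    wOutT δ lam (w₁ ++ w₂) v = wOutT δ lam w₂ (wOutT δ lam w₁ v) := by
  simp [wOutT]

theorem length_wOutT (w : List (Q ⊕ Q)) (v : List A) :
    (wOutT δ lam w v).length = v.length := by
  induction w generalizing v with
  | nil => rfl
  | cons x w ih => rw [wOutT_cons, ih, length_tOutT]

theorem wOutT_nil (w : List (Q ⊕ Q)) : wOutT δ lam w [] = [] :=
  List.length_eq_zero_iff.1 (length_wOutT δ lam w [])

theorem secTW_append (w : List (Q ⊕ Q)) (v₁ v₂ : List A) :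
    secTW δ lam w (v₁ ++ v₂) = secTW δ lam (secTW δ lam w v₁) v₂ := by
  simp [secTW]

theorem exists_wOutT_cons (w : List (Q ⊕ Q)) (a : A) :
    ∃ b, ∀ v, wOutT δ lam w (a :: v) = b :: wOutT δ lam (secT δ lam w a) v := by
  induction w generalizing a with
  | nil => exact ⟨a, fun _ => rfl⟩
  | cons x w ih =>
    obtain ⟨b, hb⟩ := ih (stepT δ lam x a).2
    exact ⟨b, fun v => by simp only [wOutT_cons, tOutT, secT, hb]⟩

theorem wOutT_append (w : List (Q ⊕ Q)) (v₁ v₂ : List A) :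
    wOutT δ lam w (v₁ ++ v₂) = wOutT δ lam w v₁ ++ wOutT δ lam (secTW δ lam w v₁) v₂ := by
  induction v₁ generalizing w with
  | nil => simp [wOutT_nil, secTW]
  | cons a v ih =>
    obtain ⟨b, hb⟩ := exists_wOutT_cons δ lam w a
    simp [hb, ih, secTW]

theorem wOutT_append_eq_self_iff (w : List (Q ⊕ Q)) (v₁ v₂ : List A) :
    wOutT δ lam w (v₁ ++ v₂) = v₁ ++ v₂ ↔
      wOutT δ lam w v₁ = v₁ ∧ wOutT δ lam (secTW δ lam w v₁) v₂ = v₂ := by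
  rw [wOutT_append]
  exact ⟨fun h => List.append_inj h (length_wOutT δ lam w v₁), fun h => by rw [h.1, h.2]⟩

theorem tOutT_inl (q : Q) (v : List A) : tOutT δ lam (Sum.inl q) v = tOut δ lam q v := by
  induction v generalizing q with
  | nil => rfl
  | cons a v ih => simp [tOutT, tOut, stepT, ih]

theorem wOutT_rep_mul_eq_self {w : List (Q ⊕ Q)} {u : List A} {p : ℕ}
    (hsec : secTW δ lam w (rep u p) = w) (hout : wOutT δ lam w (rep u p) = rep u p) (j : ℕ) :
    wOutT δ lam w (rep u (p * j)) = rep u (p * j) := by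
  induction j with
  | zero => exact wOutT_nil δ lam w
  | succ j ih =>
    rw [Nat.mul_succ, Nat.add_comm, rep_add, wOutT_append_eq_self_iff, hsec]
    exact ⟨hout, ih⟩

variable {lam}

theorem stepT_swap (hinv : ∀ q, Function.Bijective (lam q)) (x : Q ⊕ Q) (a : A) :
    stepT δ lam x.swap (stepT δ lam x a).2 = ((stepT δ lam x a).1.swap, a) := by
  rcases x with q | q
  · simp [stepT, Function.leftInverse_invFun (hinv q).1 a]
  · simp [stepT, Function.rightInverse_invFun (hinv q).2 a]

theorem tOutT_swap (hinv : ∀ q, Function.Bijective (lam q)) (x : Q ⊕ Q) (v : List A) :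
    tOutT δ lam x.swap (tOutT δ lam x v) = v := by
  induction v generalizing x with
  | nil => rfl
  | cons a v ih => simp [tOutT, stepT_swap δ hinv, ih]

theorem exists_wOutT_leftInverse (hinv : ∀ q, Function.Bijective (lam q))
    (w : List (Q ⊕ Q)) :
    ∃ w', ∀ v, wOutT δ lam w' (wOutT δ lam w v) = v := by
  induction w with
  | nil => exact ⟨[], fun _ => rfl⟩
  | cons x w ih =>
    obtain ⟨w', hw'⟩ := ih
    refine ⟨w' ++ [x.swap], fun v => ?_⟩
    rw [wOutT_append_left, wOutT_cons δ lam x w, hw']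
    exact tOutT_swap δ hinv x v

theorem exists_wOutT_of_mem_autGroup (hinv : ∀ q, Function.Bijective (lam q))
    {g : Equiv.Perm (List A)} (hg : g ∈ autGroup δ lam) :
    ∃ w, ∀ v, g v = wOutT δ lam w v := by
  induction hg using Subgroup.closure_induction with
  | mem g hg =>
    obtain ⟨q, hq⟩ := hg
    exact ⟨[Sum.inl q], fun v => (hq v).trans (tOutT_inl δ lam q v).symm⟩
  | one => exact ⟨[], fun _ => rfl⟩
  | mul g h _ _ ihg ihh =>
    obtain ⟨w₁, h₁⟩ := ihg
    obtain ⟨w₂, h₂⟩ := ihh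
    exact ⟨w₂ ++ w₁, fun v => by rw [wOutT_append_left, ← h₂, ← h₁, Equiv.Perm.mul_apply]⟩
  | inv g _ ih =>
    obtain ⟨w, hw⟩ := ih
    obtain ⟨w', hw'⟩ := exists_wOutT_leftInverse δ hinv w
    exact ⟨w', fun v => by rw [← hw' (g⁻¹ v), ← hw (g⁻¹ v), Equiv.Perm.coe_inv, Equiv.apply_symm_apply]⟩

end

end Paper

open Paper


/-- if `G(𝒜)` is infinite and all periodic boundary points have trivial
stabilizers, then the semigroup of the enriched dual is torsion-free. -/
theorem statement_16 {Q A : Type*} [Fintype Q] [Fintype A] [Nonempty Q] [Nonempty A]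
    (δ : Q → A → Q) (lam : Q → A → A) (hinv : ∀ q, Function.Bijective (lam q))
    (hG : Set.Infinite (autGroup δ lam : Set (Equiv.Perm (List A))))
    (hfree : ∀ w : List A, w ≠ [] → ∀ g ∈ autGroup δ lam,
      boundaryAct (⇑g) (perSeq w) = perSeq w → g = 1) :
    ∀ u : List A, u ≠ [] → ∀ k p : ℕ, 1 ≤ k → 1 ≤ p →
      (fun w : List (Q ⊕ Q) => secTW δ lam w (rep u (k + p))) ≠
      (fun w : List (Q ⊕ Q) => secTW δ lam w (rep u k)) := by
  intro u hu k p _ hp heq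
  have hlen : 0 < u.length := List.length_pos_iff.2 hu
  have key : ∀ g ∈ autGroup δ lam, g (rep u (k + p)) = rep u (k + p) → g = 1 := by
    intro g hg hfix
    obtain ⟨w, hw⟩ := exists_wOutT_of_mem_autGroup δ hinv hg
    have hsec : secTW δ lam w (rep u (k + p)) = secTW δ lam w (rep u k) := congrFun heq w
    rw [rep_add, secTW_append] at hsec
    rw [hw, rep_add, wOutT_append_eq_self_iff] at hfix
    have hall (j : ℕ) : wOutT δ lam w (rep u (k + p * j)) = rep u (k + p * j) := by
      rw [rep_add, wOutT_append_eq_self_iff]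
      exact ⟨hfix.1, wOutT_rep_mul_eq_self δ lam hsec hfix.2 j⟩
    refine hfree u hu g hg (funext fun i => ?_)
    have hle : i + 1 ≤ (k + p * (i + 1)) * u.length :=
      calc i + 1 ≤ p * (i + 1) := Nat.le_mul_of_pos_left _ hp
        _ ≤ k + p * (i + 1) := Nat.le_add_left _ _
        _ ≤ _ := Nat.le_mul_of_pos_right _ hlen
    obtain ⟨t, ht⟩ := map_perSeq_prefix_rep hle
    have hpre := hall (i + 1)
    rw [← ht, wOutT_append_eq_self_iff] at hpre
    simp [boundaryAct, hw, hpre.1]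
  have hmaps : Set.MapsTo (fun g : Equiv.Perm (List A) => g (rep u (k + p)))
      (autGroup δ lam : Set (Equiv.Perm (List A)))
      {v : List A | v.length = (rep u (k + p)).length} := by
    intro g hg
    obtain ⟨w, hw⟩ := exists_wOutT_of_mem_autGroup δ hinv hg
    simp only [Set.mem_ofPred_eq, hw, length_wOutT]
  refine hG (Set.Finite.of_injOn hmaps ?_ (List.finite_length_eq A _))
  intro g hg h hh hgh
  refine (inv_mul_eq_one.1 (key (g⁻¹ * h) (mul_mem (inv_mem hg) hh) ?_))
  rw [Equiv.Perm.mul_apply, Equiv.Perm.inv_eq_iff_eq]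
  exact hgh.symm
end

section
/- Let ℬ = (Q,Ã,δ,λ) be an inverse transducer and p ∈ Q a state such that L_O(ℬ,p) = L_I(ℬ,p). Then the output automaton of the connected component of p is isomorphic to its input automaton: there is a bijection ψ of the connected component C = {p·w : w ∈ Ã*} with ψ(p) = p such that δ(ψ(s), λ(s,x)) = ψ(δ(s,x)) for all s ∈ C and x ∈ Ã; in particular, λ(s,·) : Ã → Ã is injective for every s ∈ C (the output automaton of the component is deterministic). -/
open Paper


namespace Paper

/-- Iterated transition function. -/
def delStar {Q B : Type*} (δ : Q → B → Q) (q : Q) (w : List B) : Q := w.foldl δ q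

/-- ℬ is an inverse transducer over the involutive alphabet `Ã = A ⊕ A`
(the involution being `Sum.swap`). -/
def InvTrans {Q A : Type*} (δ : Q → A ⊕ A → Q) (lam : Q → A ⊕ A → A ⊕ A) : Prop :=
  ∀ q x, δ (δ q x) x.swap = q ∧ lam (δ q x) x.swap = (lam q x).swap

/-- Input language: loops at `q`. -/
def LI {Q B : Type*} (δ : Q → B → Q) (q : Q) : Set (List B) := {w | delStar δ q w = q}

/-- Output language: outputs of loops at `q`. -/
def LO {Q B : Type*} (δ : Q → B → Q) (lam : Q → B → B) (q : Q) : Set (List B) :=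
  {v | ∃ w, delStar δ q w = q ∧ tOut δ lam q w = v}

/-- Connected component of a state. -/
def comp {Q B : Type*} (δ : Q → B → Q) (q : Q) : Set Q := {q' | ∃ w, delStar δ q w = q'}

end Paper

namespace Paper

section Paths

variable {Q B : Type*} (δ : Q → B → Q) (lam : Q → B → B)

theorem delStar_append (q : Q) (u v : List B) :
    delStar δ q (u ++ v) = delStar δ (delStar δ q u) v :=
  List.foldl_append

theorem tOut_append (q : Q) (u v : List B) :
    tOut δ lam q (u ++ v) = tOut δ lam q u ++ tOut δ lam (delStar δ q u) v := by
  induction u generalizing q with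
  | nil => rfl
  | cons a u ih => simp [tOut, delStar, ih]

theorem tOut_take (q : Q) (w : List B) (n : ℕ) :
    tOut δ lam q (w.take n) = (tOut δ lam q w).take n := by
  induction w generalizing q n with
  | nil => simp [tOut]
  | cons a w ih => cases n <;> simp [tOut, ih]

end Paths

/-- The formal inverse of a word over the involutive alphabet `A ⊕ A`. -/
def invWord {A : Type*} (w : List (A ⊕ A)) : List (A ⊕ A) := (w.map Sum.swap).reverse

namespace InvTrans

variable {Q A : Type*} {δ : Q → A ⊕ A → Q} {lam : Q → A ⊕ A → A ⊕ A} {p : Q}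

theorem delStar_invWord (hB : InvTrans δ lam) (q : Q) (w : List (A ⊕ A)) :
    delStar δ (delStar δ q w) (invWord w) = q := by
  induction w generalizing q with
  | nil => rfl
  | cons a w ih =>
    have h : invWord (a :: w) = invWord w ++ [a.swap] := by simp [invWord]
    rw [h, delStar_append]
    change δ (delStar δ (delStar δ (δ q a) w) (invWord w)) a.swap = q
    rw [ih, (hB q a).1]

theorem tOut_invWord (hB : InvTrans δ lam) (q : Q) (w : List (A ⊕ A)) :
    tOut δ lam (delStar δ q w) (invWord w) = invWord (tOut δ lam q w) := by
  induction w generalizing q with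
  | nil => rfl
  | cons a w ih =>
    have h (b : A ⊕ A) (v) : invWord (b :: v) = invWord v ++ [b.swap] := by simp [invWord]
    rw [h, tOut_append]
    change tOut δ lam (delStar δ (δ q a) w) (invWord w) ++
      tOut δ lam (delStar δ (delStar δ (δ q a) w) (invWord w)) [a.swap] =
        invWord (lam q a :: tOut δ lam (δ q a) w)
    rw [h, ih, hB.delStar_invWord, tOut, tOut, (hB q a).2]

theorem delStar_eq_of_append_invWord (hB : InvTrans δ lam) {q r : Q} {u v : List (A ⊕ A)}
    (h : delStar δ q (u ++ invWord v) = r) : delStar δ q u = delStar δ r v := by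
  -- Both sides are sent to `r` by `invWord v`, which acts injectively.
  have inj : Function.Injective fun s => delStar δ s (invWord v) := by
    intro s t hst
    have := congrArg (fun x => delStar δ x (invWord (invWord v))) hst
    simpa [hB.delStar_invWord] using this
  apply inj
  simpa [hB.delStar_invWord, delStar_append] using h

/-- If every output of a loop at `p` is a loop at `p`, then reading outputs is compatible with
the equality of end points. -/
theorem delStar_tOut_congr (hB : InvTrans δ lam) (hp : LO δ lam p ⊆ LI δ p)
    {u v : List (A ⊕ A)} (h : delStar δ p u = delStar δ p v) :
    delStar δ p (tOut δ lam p u) = delStar δ p (tOut δ lam p v) := by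
  apply hB.delStar_eq_of_append_invWord
  refine hp ⟨u ++ invWord v, ?_, ?_⟩
  · rw [delStar_append, h, hB.delStar_invWord]
  · rw [tOut_append, h, hB.tOut_invWord]

/-- If every loop at `p` is the output of a loop at `p`, then every word is an output at `p`. -/
theorem tOut_surjective (hB : InvTrans δ lam) (hp : LI δ p ⊆ LO δ lam p) :
    Function.Surjective (tOut δ lam p) := by
  intro v
  have hv : v ++ invWord v ∈ LI δ p := by
    change delStar δ p _ = p
    rw [delStar_append, hB.delStar_invWord]
  obtain ⟨w, -, hw⟩ := hp hv
  exact ⟨w.take v.length, by rw [tOut_take, hw, List.take_left]⟩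

end InvTrans

end Paper

/-- if `L_O(ℬ,p) = L_I(ℬ,p)` for an inverse transducer ℬ, then the output
automaton of the component of `p` is isomorphic to its input automaton; in particular the
output labelling is deterministic on the component. -/
theorem statement_19 {Q A : Type*} [Fintype Q] [Fintype A] [Nonempty Q] [Nonempty A]
    (δ : Q → A ⊕ A → Q) (lam : Q → A ⊕ A → A ⊕ A) (hB : InvTrans δ lam)
    (p : Q) (hp : LO δ lam p = LI δ p) :
    (∃ ψ : Q → Q, Set.BijOn ψ (comp δ p) (comp δ p) ∧ ψ p = p ∧
      ∀ s ∈ comp δ p, ∀ x : A ⊕ A, δ (ψ s) (lam s x) = ψ (δ s x)) ∧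
    (∀ s ∈ comp δ p, Function.Injective (lam s)) := by
  classical
  let ψ : Q → Q := fun s =>
    if h : s ∈ comp δ p then delStar δ p (tOut δ lam p h.choose) else s
  have ψ_delStar (w : List (A ⊕ A)) :
      ψ (delStar δ p w) = delStar δ p (tOut δ lam p w) := by
    have h : delStar δ p w ∈ comp δ p := ⟨w, rfl⟩
    simp only [ψ, dif_pos h]
    exact hB.delStar_tOut_congr hp.subset h.choose_spec
  have mapsTo : Set.MapsTo ψ (comp δ p) (comp δ p) := by
    rintro _ ⟨w, rfl⟩
    exact ⟨_, (ψ_delStar w).symm⟩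
  have surjOn : Set.SurjOn ψ (comp δ p) (comp δ p) := by
    rintro _ ⟨v, rfl⟩
    obtain ⟨w, rfl⟩ := hB.tOut_surjective hp.symm.subset v
    exact ⟨_, ⟨w, rfl⟩, ψ_delStar w⟩
  have injOn : Set.InjOn ψ (comp δ p) :=
    ((Set.toFinite _).surjOn_iff_bijOn_of_mapsTo mapsTo).1 surjOn |>.injOn
  refine ⟨⟨ψ, ⟨mapsTo, injOn, surjOn⟩, ψ_delStar [], ?_⟩, ?_⟩
  · rintro _ ⟨w, rfl⟩ x
    have h := ψ_delStar (w ++ [x])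
    rw [tOut_append, delStar_append, delStar_append, ← ψ_delStar] at h
    exact h.symm
  · rintro _ ⟨w, rfl⟩
    refine Finite.injective_iff_surjective.2 fun y => ?_
    obtain ⟨u, hu⟩ := hB.tOut_surjective hp.symm.subset (tOut δ lam p w ++ [y])
    obtain rfl | ⟨v, x, rfl⟩ := u.eq_nil_or_concat'
    · simp [tOut] at hu
    · rw [tOut_append] at hu
      obtain ⟨hv, hx⟩ := List.append_inj' hu rfl
      have hvw : delStar δ p v = delStar δ p w :=
        injOn ⟨v, rfl⟩ ⟨w, rfl⟩ (by rw [ψ_delStar, ψ_delStar, hv])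
      exact ⟨x, by simpa [tOut, hvw] using hx⟩
end
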